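/- Let u₂ : ℝ³ → ℝ³ be a smooth divergence-free vector field with u₂ and ∇×u₂ bounded, let u : ℝ³ → ℝ³ be smooth with u and ∇u in L²((1+|x|²)^{−k}dx) for some k > 3/2, and let w(x) = (1+|x|²)^{−k}. Then |∫_{ℝ³} w |u|² u₂·(∇×∇×u₂) dx| ≤ C(‖u₂‖_∞² + ‖∇×u₂‖_∞²) ∫_{ℝ³} w (|u|² + |∇u|²) dx. -/

import Mathlib

open MeasureTheory RealInnerProductSpace

noncomputable section

abbrev E3 := EuclideanSpace ℝ (Fin 3)

def pd (f : E3 → ℝ) (i : Fin 3) (x : E3) : ℝ :=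
  fderiv ℝ f x (EuclideanSpace.single i 1)

/-- Curl of a vector field on `ℝ³`. -/
def curl (v : E3 → E3) (x : E3) : E3 :=
  (WithLp.equiv 2 (Fin 3 → ℝ)).symm
    ![pd (fun y => v y 2) 1 x - pd (fun y => v y 1) 2 x,
      pd (fun y => v y 0) 2 x - pd (fun y => v y 2) 0 x,
      pd (fun y => v y 1) 0 x - pd (fun y => v y 0) 1 x]

/-- Squared Frobenius norm of the gradient of a vector field. -/
def gradsq (v : E3 → E3) (x : E3) : ℝ :=
  ∑ i, ‖gradient (fun y => v y i) x‖ ^ 2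

lemma pd_mul' {f g : E3 → ℝ} (hf : ContDiff ℝ (⊤ : ℕ∞) f) (hg : ContDiff ℝ (⊤ : ℕ∞) g) (i : Fin 3) (x : E3) :
    pd (fun y => f y * g y) i x = pd f i x * g x + f x * pd g i x := by
  unfold pd
  have h1 : DifferentiableAt ℝ f x := (hf.differentiable (by simp)) x
  have h2 : DifferentiableAt ℝ g x := (hg.differentiable (by simp)) x
  rw [fderiv_fun_mul h1 h2]
  simp
  ring

lemma pd_sub' {f g : E3 → ℝ} (hf : ContDiff ℝ (⊤ : ℕ∞) f) (hg : ContDiff ℝ (⊤ : ℕ∞) g) (i : Fin 3) (x : E3) :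
    pd (fun y => f y - g y) i x = pd f i x - pd g i x := by
  unfold pd
  have h1 : DifferentiableAt ℝ f x := (hf.differentiable (by simp)) x
  have h2 : DifferentiableAt ℝ g x := (hg.differentiable (by simp)) x
  rw [fderiv_fun_sub h1 h2]
  simp

lemma pd_smooth {f : E3 → ℝ} (hf : ContDiff ℝ (⊤ : ℕ∞) f) (i : Fin 3) :
    ContDiff ℝ (⊤ : ℕ∞) (pd f i) := by
  unfold pd
  exact (hf.fderiv_right (m := (⊤ : ℕ∞)) (by simp)).clm_apply contDiff_const

lemma comp_smooth {v : E3 → E3} (hv : ContDiff ℝ (⊤ : ℕ∞) v) (i : Fin 3) :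
    ContDiff ℝ (⊤ : ℕ∞) (fun y => v y i) :=
  contDiff_euclidean.1 hv i

lemma curl_zero (v : E3 → E3) (x : E3) :
    curl v x 0 = pd (fun y => v y 2) 1 x - pd (fun y => v y 1) 2 x := rfl
lemma curl_one (v : E3 → E3) (x : E3) :
    curl v x 1 = pd (fun y => v y 0) 2 x - pd (fun y => v y 2) 0 x := rfl
lemma curl_two (v : E3 → E3) (x : E3) :
    curl v x 2 = pd (fun y => v y 1) 0 x - pd (fun y => v y 0) 1 x := rfl

lemma curl_comp_smooth {v : E3 → E3} (hv : ContDiff ℝ (⊤ : ℕ∞) v) (i : Fin 3) :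
    ContDiff ℝ (⊤ : ℕ∞) (fun y => curl v y i) := by
  have h := fun i j => pd_smooth (comp_smooth hv i) j
  fin_cases i
  · exact (h 2 1).sub (h 1 2)
  · exact (h 0 2).sub (h 2 0)
  · exact (h 1 0).sub (h 0 1)

lemma gradsq_eq (v : E3 → E3) (x : E3) :
    gradsq v x = ∑ j, ∑ i, (pd (fun y => v y j) i x) ^ 2 := by
  unfold gradsq
  refine Finset.sum_congr rfl fun j _ => ?_
  rw [EuclideanSpace.norm_sq_eq]
  refine Finset.sum_congr rfl fun i _ => ?_
  have : gradient (fun y => v y j) x i = pd (fun y => v y j) i x := by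
    unfold pd gradient
    rw [← InnerProductSpace.toDual_symm_apply, EuclideanSpace.inner_single_right]
    simp
  rw [this, Real.norm_eq_abs, sq_abs]

lemma w_smooth (k : ℝ) : ContDiff ℝ (⊤ : ℕ∞) (fun x : E3 => (1 + ‖x‖ ^ 2) ^ (-k)) := by
  refine ContDiff.rpow_const_of_ne ?_ ?_
  · exact contDiff_const.add (contDiff_norm_sq ℝ)
  · intro x; positivity

lemma w_pd (k : ℝ) (hk : 0 ≤ k) (i : Fin 3) (x : E3) :
    |pd (fun x : E3 => (1 + ‖x‖ ^ 2) ^ (-k)) i x| ≤ k * (1 + ‖x‖ ^ 2) ^ (-k) := by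
  have hpos : 0 < 1 + ‖x‖ ^ 2 := by positivity
  have h1 : HasFDerivAt (fun x : E3 => 1 + ‖x‖ ^ 2) (2 • (innerSL ℝ x)) x :=
    ((hasStrictFDerivAt_norm_sq x).hasFDerivAt).const_add 1
  have h2 := h1.rpow_const (p := -k) (Or.inl hpos.ne')
  unfold pd
  rw [h2.fderiv, Real.rpow_sub_one hpos.ne']
  have h3 : |x i| ≤ ‖x‖ := PiLp.norm_apply_le x i
  have h4 : 2 * |x i| ≤ 1 + ‖x‖ ^ 2 := by nlinarith [sq_nonneg (‖x‖ - 1)]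
  have hw : 0 < (1 + ‖x‖ ^ 2) ^ (-k) := Real.rpow_pos_of_pos hpos _
  simp only [_root_.smul_apply, innerSL_apply_apply, EuclideanSpace.inner_single_right,
    smul_eq_mul, nsmul_eq_mul]
  simp only [conj_trivial, one_mul, abs_mul, abs_div, abs_neg, abs_of_nonneg hk, abs_of_pos hw,
    abs_of_pos hpos]
  norm_num
  have : (1 + ‖x‖ ^ 2) ^ (-k) / (1 + ‖x‖ ^ 2) * (2 * |x i|) ≤ (1 + ‖x‖ ^ 2) ^ (-k) := by
    rw [div_mul_eq_mul_div, div_le_iff₀ hpos]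
    gcongr
  nlinarith

lemma u_pd {u : E3 → E3} (hu : ContDiff ℝ (⊤ : ℕ∞) u) (i : Fin 3) (x : E3) :
    |pd (fun x : E3 => ‖u x‖ ^ 2) i x| ≤ ‖u x‖ ^ 2 + ∑ j, (pd (fun y => u y j) i x) ^ 2 := by
  have h0 : (fun x : E3 => ‖u x‖ ^ 2) = fun x => ∑ j, u x j * u x j := by
    ext x; rw [EuclideanSpace.norm_sq_eq]
    refine Finset.sum_congr rfl fun i _ => ?_
    rw [Real.norm_eq_abs, sq_abs, sq]
  have h1 : pd (fun x : E3 => ‖u x‖ ^ 2) i x = ∑ j, 2 * (u x j * pd (fun y => u y j) i x) := by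
    rw [h0]
    have : ∀ j, pd (fun y => u y j * u y j) i x = 2 * (u x j * pd (fun y => u y j) i x) := by
      intro j
      rw [pd_mul' (comp_smooth hu j) (comp_smooth hu j)]; ring
    rw [← Finset.sum_congr rfl fun j _ => this j]
    unfold pd
    rw [fderiv_fun_sum]
    · simp
    · intro j _
      exact (((comp_smooth hu j).mul (comp_smooth hu j)).differentiable (by simp)) x
  rw [h1, congrFun h0 x, ← Finset.sum_add_distrib]
  refine (Finset.abs_sum_le_sum_abs _ _).trans (Finset.sum_le_sum fun j _ => ?_)
  rw [abs_le]
  constructor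
  · nlinarith [sq_nonneg (u x j + pd (fun y => u y j) i x)]
  · nlinarith [sq_nonneg (u x j - pd (fun y => u y j) i x)]

lemma parts {χ f : E3 → ℝ} (hχ : ContDiff ℝ (⊤ : ℕ∞) χ) (hc : HasCompactSupport χ)
    (hf : ContDiff ℝ (⊤ : ℕ∞) f) (i : Fin 3) :
    Integrable (fun x => χ x * pd f i x) ∧
    ∫ x, χ x * pd f i x = - ∫ x, pd χ i x * f x := by
  have c1 : HasCompactSupport (pd χ i) := by
    unfold pd
    exact (hc.fderiv (𝕜 := ℝ)).comp_left (g := fun L : E3 →L[ℝ] ℝ => L (EuclideanSpace.single i 1)) (by simp)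
  have i1 : Integrable (fun x => χ x * pd f i x) :=
    (hχ.continuous.mul (pd_smooth hf i).continuous).integrable_of_hasCompactSupport hc.mul_right
  have i2 : Integrable (fun x => pd χ i x * f x) :=
    ((pd_smooth hχ i).continuous.mul hf.continuous).integrable_of_hasCompactSupport c1.mul_right
  have i3 : Integrable (fun x => χ x * f x) :=
    (hχ.continuous.mul hf.continuous).integrable_of_hasCompactSupport hc.mul_right
  refine ⟨i1, ?_⟩
  exact integral_mul_fderiv_eq_neg_fderiv_mul_of_integrable i2 i1 i3
    (fun x _ => hχ.differentiable (by simp) x) (fun x _ => hf.differentiable (by simp) x)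

lemma div_zero_int (V : Fin 3 → E3 → ℝ) (hV : ∀ i, ContDiff ℝ (⊤ : ℕ∞) (V i))
    (hi : ∀ i, Integrable (V i)) (hd : Integrable (fun x => ∑ i, pd (V i) i x)) :
    ∫ x, ∑ i, pd (V i) i x = 0 := by
  let b : ContDiffBump (0 : E3) := ⟨1, 2, by norm_num, by norm_num⟩
  have hb : ContDiff ℝ (⊤ : ℕ∞) (b : E3 → ℝ) := b.contDiff
  let c : ℕ → ℝ := fun n => 1 / ((n : ℝ) + 1)
  have hcpos : ∀ n, 0 < c n := fun n => by positivity
  have hc0 : Filter.Tendsto c Filter.atTop (nhds 0) := tendsto_one_div_add_atTop_nhds_zero_nat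
  let χ : ℕ → E3 → ℝ := fun n x => b (c n • x)
  have hχ : ∀ n, ContDiff ℝ (⊤ : ℕ∞) (χ n) := fun n => hb.comp (contDiff_const_smul (c n))
  have hχc : ∀ n, HasCompactSupport (χ n) := fun n =>
    b.hasCompactSupport.comp_smul (hcpos n).ne'
  have hpd : ∀ n i x, pd (χ n) i x = c n * pd b i (c n • x) := by
    intro n i x
    unfold pd
    have h1 : HasFDerivAt (fun x : E3 => c n • x) (c n • ContinuousLinearMap.id ℝ E3) x :=
      (hasFDerivAt_id x).const_smul (c n)
    have h2 := ((hb.differentiable (by simp)) (c n • x)).hasFDerivAt.comp x h1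
    have : fderiv ℝ (χ n) x = _ := h2.fderiv
    rw [this]; simp
  have hbd : ∀ i, ∃ K, ∀ x, ‖pd b i x‖ ≤ K := by
    intro i
    have c1 : HasCompactSupport (pd b i) := by
      unfold pd
      exact (b.hasCompactSupport.fderiv (𝕜 := ℝ)).comp_left (g := fun L : E3 →L[ℝ] ℝ => L (EuclideanSpace.single i 1)) (by simp)
    exact c1.exists_bound_of_continuous (pd_smooth hb i).continuous
  choose K hK using hbd
  have key : ∀ n, ∫ x, χ n x * ∑ i, pd (V i) i x = - ∑ i, c n * ∫ x, pd b i (c n • x) * V i x := by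
    intro n
    simp_rw [Finset.mul_sum]
    rw [integral_finsetSum _ (fun i _ => (parts (hχ n) (hχc n) (hV i) i).1), ← Finset.sum_neg_distrib]
    refine Finset.sum_congr rfl fun i _ => ?_
    rw [(parts (hχ n) (hχc n) (hV i) i).2, ← integral_const_mul]
    simp_rw [hpd, mul_assoc]
  have l1 : Filter.Tendsto (fun n => ∫ x, χ n x * ∑ i, pd (V i) i x) Filter.atTop
      (nhds (∫ x, ∑ i, pd (V i) i x)) := by
    refine tendsto_integral_of_dominated_convergence (fun x => ‖∑ i, pd (V i) i x‖) ?_ hd.norm ?_ ?_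
    · intro n
      exact (hχ n).continuous.aestronglyMeasurable.mul hd.aestronglyMeasurable
    · intro n
      refine Filter.Eventually.of_forall fun x => ?_
      rw [norm_mul]
      have : ‖χ n x‖ ≤ 1 := by
        rw [Real.norm_eq_abs, abs_of_nonneg b.nonneg]; exact b.le_one
      nlinarith [norm_nonneg (∑ i, pd (V i) i x)]
    · refine Filter.Eventually.of_forall fun x => ?_
      have h1 : Filter.Tendsto (fun n => c n • x) Filter.atTop (nhds (0 : E3)) := by
        simpa using hc0.smul_const x
      have h2 : Filter.Tendsto (fun n => χ n x) Filter.atTop (nhds 1) := by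
        have := (hb.continuous.tendsto 0).comp h1
        have hb0 : b (0 : E3) = 1 := b.one_of_mem_closedBall (by simp [b])
        rwa [hb0] at this
      simpa using h2.mul_const (∑ i, pd (V i) i x)
  have l2 : Filter.Tendsto (fun n => ∫ x, χ n x * ∑ i, pd (V i) i x) Filter.atTop (nhds 0) := by
    simp_rw [key]
    have : ∀ i ∈ (Finset.univ : Finset (Fin 3)), Filter.Tendsto (fun n => c n * ∫ x, pd b i (c n • x) * V i x) Filter.atTop (nhds 0) := by
      intro i _
      refine squeeze_zero_norm (a := fun n => c n * (∫ x, K i * ‖V i x‖)) ?_ ?_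
      · intro n
        rw [norm_mul, Real.norm_of_nonneg (hcpos n).le]
        refine mul_le_mul_of_nonneg_left ?_ (hcpos n).le
        refine norm_integral_le_of_norm_le ((hi i).norm.const_mul _) (Filter.Eventually.of_forall fun x => ?_)
        rw [norm_mul]
        exact mul_le_mul_of_nonneg_right (hK i _) (norm_nonneg _)
      · simpa using hc0.mul_const (∫ x, K i * ‖V i x‖)
    simpa using (tendsto_finsetSum _ this).neg
  exact tendsto_nhds_unique l1 l2

/-- Weighted curl–curl estimate: for divergence-free `u₂` with `u₂, ∇×u₂`
bounded, `|∫ w|u|² u₂·(∇×∇×u₂)| ≤ C(‖u₂‖∞² + ‖∇×u₂‖∞²) ∫ w(|u|²+|∇u|²)` with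
`w = (1+|x|²)^{−k}`, `k > 3/2`, `C = C(k)`. -/
theorem stmt15 (k : ℝ) (hk : 3 / 2 < k) :
    ∃ C > (0:ℝ), ∀ (u₂ u : E3 → E3) (M₁ M₂ : ℝ),
      ContDiff ℝ (⊤ : ℕ∞) u₂ → ContDiff ℝ (⊤ : ℕ∞) u →
      (∀ x, ∑ i, pd (fun y => u₂ y i) i x = 0) →
      (∀ x, ‖u₂ x‖ ≤ M₁) → (∀ x, ‖curl u₂ x‖ ≤ M₂) →
      Integrable (fun x => (1 + ‖x‖ ^ 2) ^ (-k) * (‖u x‖ ^ 2 + gradsq u x)) →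
      Integrable (fun x =>
        (1 + ‖x‖ ^ 2) ^ (-k) * ‖u x‖ ^ 2 * ⟪u₂ x, curl (curl u₂) x⟫) →
      |∫ x, (1 + ‖x‖ ^ 2) ^ (-k) * ‖u x‖ ^ 2 * ⟪u₂ x, curl (curl u₂) x⟫|
        ≤ C * (M₁ ^ 2 + M₂ ^ 2) *
          ∫ x, (1 + ‖x‖ ^ 2) ^ (-k) * (‖u x‖ ^ 2 + gradsq u x) := by

  refine ⟨3 * k + 4, by linarith, ?_⟩
  intro u₂ u M₁ M₂ hu₂ hu _ hM₁ hM₂ hI hG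
  let w : E3 → ℝ := fun x => (1 + ‖x‖ ^ 2) ^ (-k)
  let F : E3 → ℝ := fun x => w x * ‖u x‖ ^ 2
  let ω := curl u₂
  have hw : ContDiff ℝ (⊤ : ℕ∞) w := w_smooth k
  have hwpos : ∀ x, 0 < w x := fun x => Real.rpow_pos_of_pos (by positivity) _
  have hus : ContDiff ℝ (⊤ : ℕ∞) (fun x => ‖u x‖ ^ 2) := hu.norm_sq ℝ
  have hF : ContDiff ℝ (⊤ : ℕ∞) F := hw.mul hus
  have ha : ∀ i, ContDiff ℝ (⊤ : ℕ∞) (fun y => u₂ y i) := comp_smooth hu₂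
  have hb : ∀ i, ContDiff ℝ (⊤ : ℕ∞) (fun y => ω y i) := curl_comp_smooth hu₂
  have hM1 : 0 ≤ M₁ := (norm_nonneg _).trans (hM₁ 0)
  have hM2 : 0 ≤ M₂ := (norm_nonneg _).trans (hM₂ 0)
  have hgs : ∀ x, 0 ≤ gradsq u x := fun x => Finset.sum_nonneg fun i _ => by positivity
  have hF0 : ∀ x, 0 ≤ F x := fun x => mul_nonneg (hwpos x).le (by positivity)
  have hFI : Integrable F := by
    refine hI.mono' hF.continuous.aestronglyMeasurable (Filter.Eventually.of_forall fun x => ?_)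
    rw [Real.norm_of_nonneg (hF0 x)]
    exact mul_le_mul_of_nonneg_left (by linarith [hgs x]) (hwpos x).le
  -- the cross product
  let W : Fin 3 → E3 → ℝ := fun i y =>
    ω y (i + 1) * u₂ y (i + 2) - ω y (i + 2) * u₂ y (i + 1)
  have hW : ∀ i, ContDiff ℝ (⊤ : ℕ∞) (W i) := fun i =>
    ((hb _).mul (ha _)).sub ((hb _).mul (ha _))
  have hWb : ∀ i x, |W i x| ≤ M₁ ^ 2 + M₂ ^ 2 := by
    intro i x
    have e1 : ∀ j, |u₂ x j| ≤ M₁ := fun j => (PiLp.norm_apply_le (u₂ x) j).trans (hM₁ x)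
    have e2 : ∀ j, |ω x j| ≤ M₂ := fun j => (PiLp.norm_apply_le (ω x) j).trans (hM₂ x)
    have e3 : ∀ j l, |ω x j * u₂ x l| ≤ M₂ * M₁ := fun j l => by
      rw [abs_mul]
      exact mul_le_mul (e2 j) (e1 l) (abs_nonneg _) hM2
    have := abs_sub (ω x (i + 1) * u₂ x (i + 2)) (ω x (i + 2) * u₂ x (i + 1))
    have := e3 (i+1) (i+2)
    have := e3 (i+2) (i+1)
    show |ω x (i + 1) * u₂ x (i + 2) - ω x (i + 2) * u₂ x (i + 1)| ≤ _
    nlinarith [sq_nonneg (M₁ - M₂)]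
  let V : Fin 3 → E3 → ℝ := fun i y => F y * W i y
  have hV : ∀ i, ContDiff ℝ (⊤ : ℕ∞) (V i) := fun i => hF.mul (hW i)
  have hVI : ∀ i, Integrable (V i) := by
    intro i
    refine (hFI.mul_const (M₁ ^ 2 + M₂ ^ 2)).mono' (hV i).continuous.aestronglyMeasurable
      (Filter.Eventually.of_forall fun x => ?_)
    rw [Real.norm_eq_abs, abs_mul, abs_of_nonneg (hF0 x)]
    exact mul_le_mul_of_nonneg_left (hWb i x) (hF0 x)
  let H : E3 → ℝ := fun x => F x * (∑ i, ω x i ^ 2) - ∑ i, pd F i x * W i x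
  have hHc : Continuous H := by
    refine (hF.continuous.mul (continuous_finsetSum _ fun i _ => (hb i).continuous.pow 2)).sub
      (continuous_finsetSum _ fun i _ => (pd_smooth hF i).continuous.mul (hW i).continuous)
  have hdiv : ∀ x, ∑ i, pd (V i) i x =
      (1 + ‖x‖ ^ 2) ^ (-k) * ‖u x‖ ^ 2 * ⟪u₂ x, curl (curl u₂) x⟫ - H x := by
    intro x
    have e1 : ∀ i, pd (V i) i x = pd F i x * W i x + F x * (
        (pd (fun y => ω y (i+1)) i x * u₂ x (i+2) + ω x (i+1) * pd (fun y => u₂ y (i+2)) i x)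
        - (pd (fun y => ω y (i+2)) i x * u₂ x (i+1) + ω x (i+2) * pd (fun y => u₂ y (i+1)) i x)) := by
      intro i
      rw [pd_mul' hF (hW i), pd_sub' ((hb _).mul (ha _)) ((hb _).mul (ha _)),
        pd_mul' (hb _) (ha _), pd_mul' (hb _) (ha _)]
    have e2 : ⟪u₂ x, curl (curl u₂) x⟫ = ∑ i, u₂ x i * curl ω x i := by
      simp [PiLp.inner_apply, ω, mul_comm]
    have o0 : ω x 0 = pd (fun y => u₂ y 2) 1 x - pd (fun y => u₂ y 1) 2 x := rfl
    have o1 : ω x 1 = pd (fun y => u₂ y 0) 2 x - pd (fun y => u₂ y 2) 0 x := rfl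
    have o2 : ω x 2 = pd (fun y => u₂ y 1) 0 x - pd (fun y => u₂ y 0) 1 x := rfl
    have hFx : (1 + ‖x‖ ^ 2) ^ (-k) * ‖u x‖ ^ 2 = F x := rfl
    have s1 : (1 : Fin 3) + 1 = 2 := rfl
    have s2 : (1 : Fin 3) + 2 = 0 := rfl
    have s3 : (2 : Fin 3) + 1 = 0 := rfl
    have s4 : (2 : Fin 3) + 2 = 1 := rfl
    rw [e2, hFx]
    simp only [e1, H, Fin.sum_univ_three, curl_zero, curl_one, curl_two, zero_add, s1, s2, s3, s4]
    linear_combination (F x) * (ω x 0 * o0 + ω x 1 * o1 + ω x 2 * o2)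
  have hpdF : ∀ x, ∑ i, |pd F i x| ≤ (3 * k + 3) * (w x * (‖u x‖ ^ 2 + gradsq u x)) := by
    intro x
    have e : ∀ i, |pd F i x| ≤ k * w x * ‖u x‖ ^ 2 +
        w x * (‖u x‖ ^ 2 + ∑ j, (pd (fun y => u y j) i x) ^ 2) := by
      intro i
      rw [pd_mul' hw hus]
      refine (abs_add_le _ _).trans (add_le_add ?_ ?_)
      · rw [abs_mul, abs_of_nonneg (sq_nonneg ‖u x‖)]
        exact mul_le_mul_of_nonneg_right (w_pd k (by linarith) i x) (sq_nonneg _)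
      · rw [abs_mul, abs_of_pos (hwpos x)]
        exact mul_le_mul_of_nonneg_left (u_pd hu i x) (hwpos x).le
    refine (Finset.sum_le_sum fun i _ => e i).trans ?_
    have hg : ∑ i, ∑ j, (pd (fun y => u y j) i x) ^ 2 = gradsq u x := by
      rw [gradsq_eq, Finset.sum_comm]
    rw [Finset.sum_add_distrib, ← Finset.mul_sum, ← Finset.mul_sum, Finset.sum_add_distrib, hg]
    simp only [Finset.sum_const, Finset.card_univ, Fintype.card_fin, nsmul_eq_mul]
    have := mul_nonneg (hwpos x).le (hgs x)
    have := mul_nonneg (by linarith : 0 ≤ 3 * k + 2) this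
    push_cast
    linarith
  have hHb : ∀ x, ‖H x‖ ≤ (3 * k + 4) * (M₁ ^ 2 + M₂ ^ 2) *
      ((1 + ‖x‖ ^ 2) ^ (-k) * (‖u x‖ ^ 2 + gradsq u x)) := by
    intro x
    have e0 : ∑ i, ω x i ^ 2 ≤ M₁ ^ 2 + M₂ ^ 2 := by
      have : ∑ i, ω x i ^ 2 = ‖ω x‖ ^ 2 := by
        rw [EuclideanSpace.norm_sq_eq]; simp
      rw [this]
      have := pow_le_pow_left₀ (norm_nonneg _) (hM₂ x) 2
      nlinarith [sq_nonneg M₁]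
    have hMM : 0 ≤ M₁ ^ 2 + M₂ ^ 2 := by positivity
    have e1 : |F x * (∑ i, ω x i ^ 2)| ≤ (w x * (‖u x‖ ^ 2 + gradsq u x)) * (M₁ ^ 2 + M₂ ^ 2) := by
      rw [abs_of_nonneg (mul_nonneg (hF0 x) (by positivity))]
      have : F x ≤ w x * (‖u x‖ ^ 2 + gradsq u x) :=
        mul_le_mul_of_nonneg_left (by linarith [hgs x]) (hwpos x).le
      exact mul_le_mul this e0 (by positivity) ((hF0 x).trans this)
    have e2 : |∑ i, pd F i x * W i x| ≤
        ((3 * k + 3) * (w x * (‖u x‖ ^ 2 + gradsq u x))) * (M₁ ^ 2 + M₂ ^ 2) := by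
      refine (Finset.abs_sum_le_sum_abs _ _).trans ?_
      refine le_trans ?_ (mul_le_mul_of_nonneg_right (hpdF x) hMM)
      rw [Finset.sum_mul]
      refine Finset.sum_le_sum fun i _ => ?_
      rw [abs_mul]
      exact mul_le_mul_of_nonneg_left (hWb i x) (abs_nonneg _)
    rw [Real.norm_eq_abs]
    refine (abs_sub _ _).trans ((add_le_add e1 e2).trans (le_of_eq ?_))
    simp only [w]
    ring
  have hHI : Integrable H :=
    (hI.const_mul _).mono' hHc.aestronglyMeasurable (Filter.Eventually.of_forall hHb)
  have hz := div_zero_int V hV hVI (by simp_rw [hdiv]; exact hG.sub hHI)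
  simp_rw [hdiv] at hz
  rw [integral_sub hG hHI] at hz
  rw [sub_eq_zero.1 hz, ← integral_const_mul]
  exact norm_integral_le_of_norm_le (hI.const_mul _) (Filter.Eventually.of_forall hHb)
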